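/- arXiv:2303.15783 — 4 statements merged into one kernel-verified Lean document; each statement's English description precedes it below -/
import Mathlib

section
/- Logicality: For every proof term γ over a string rewrite system (Σ, R) with source string s and target string t, there exists a reduction γ' (an empty multistep or a right-associated vertical composition of single steps) with source s and target t such that γ and γ' are permutation equivalent. -/
universe u

/-- A string rewrite system over alphabet `α`: a type of rules with nonempty
left- and right-hand side strings. -/
structure SRS (α : Type u) where
  Rule : Type u
  lhs : Rule → List α
  rhs : Rule → List α
  lhs_ne : ∀ ρ, lhs ρ ≠ []
  rhs_ne : ∀ ρ, rhs ρ ≠ []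

namespace SRS

variable {α : Type u}

/-- Proof terms over a string rewrite system, indexed by source and target strings. -/
inductive PT (S : SRS α) : List α → List α → Type u
  | eps : PT S [] []
  | letter (a : α) : PT S [a] [a]
  | rule (ρ : S.Rule) : PT S (S.lhs ρ) (S.rhs ρ)
  | hcomp {s₁ t₁ s₂ t₂ : List α} : PT S s₁ t₁ → PT S s₂ t₂ → PT S (s₁ ++ s₂) (t₁ ++ t₂)
  | vcomp {s t u : List α} : PT S s t → PT S t u → PT S s u

namespace PT

variable {S : SRS α}

/-- A string viewed as a proof term. -/
def ofString (S : SRS α) : (s : List α) → PT S s s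
  | [] => .eps
  | a :: s => .hcomp (.letter a) (ofString S s)

/-- The source string of a proof term. -/
def src {s t : List α} (_ : PT S s t) : List α := s

/-- The target string of a proof term. -/
def tgt {s t : List α} (_ : PT S s t) : List α := t

/-- Number of occurrences of rule symbols in a proof term. -/
def ruleCount : {s t : List α} → PT S s t → ℕ
  | _, _, .eps => 0
  | _, _, .letter _ => 0
  | _, _, .rule _ => 1
  | _, _, .hcomp γ δ => ruleCount γ + ruleCount δ
  | _, _, .vcomp γ δ => ruleCount γ + ruleCount δ

/-- A proof term contains no vertical composition (is a multistep). -/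
def noVcomp : {s t : List α} → PT S s t → Prop
  | _, _, .eps => True
  | _, _, .letter _ => True
  | _, _, .rule _ => True
  | _, _, .hcomp γ δ => noVcomp γ ∧ noVcomp δ
  | _, _, .vcomp _ _ => False

/-- An empty multistep: no vertical composition and no rule symbols. -/
def IsEmptyMS {s t : List α} (γ : PT S s t) : Prop := γ.noVcomp ∧ γ.ruleCount = 0

/-- A (single) step: a multistep with exactly one occurrence of a rule symbol. -/
def IsStep {s t : List α} (γ : PT S s t) : Prop := γ.noVcomp ∧ γ.ruleCount = 1

/-- Permutation equivalence: the least congruence containing the horizontal and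
vertical monoid laws and the exchange law. -/
inductive PermEq : ∀ {s t s' t' : List α}, PT S s t → PT S s' t' → Prop
  | refl {s t} (γ : PT S s t) : PermEq γ γ
  | symm {s t s' t'} {γ : PT S s t} {δ : PT S s' t'} : PermEq γ δ → PermEq δ γ
  | trans {s t s' t' s'' t''} {γ : PT S s t} {δ : PT S s' t'} {ζ : PT S s'' t''} :
      PermEq γ δ → PermEq δ ζ → PermEq γ ζ
  | hcongr {s₁ t₁ s₂ t₂ s₁' t₁' s₂' t₂'} {γ : PT S s₁ t₁} {γ' : PT S s₁' t₁'}
      {δ : PT S s₂ t₂} {δ' : PT S s₂' t₂'} :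
      PermEq γ γ' → PermEq δ δ' → PermEq (γ.hcomp δ) (γ'.hcomp δ')
  | vcongr {s t u s' t' u'} {γ : PT S s t} {δ : PT S t u} {γ' : PT S s' t'} {δ' : PT S t' u'} :
      PermEq γ γ' → PermEq δ δ' → PermEq (γ.vcomp δ) (γ'.vcomp δ')
  | hUnitL {s t} (γ : PT S s t) : PermEq (PT.hcomp .eps γ) γ
  | hUnitR {s t} (γ : PT S s t) : PermEq (PT.hcomp γ .eps) γ
  | hAssoc {s₁ t₁ s₂ t₂ s₃ t₃} (γ : PT S s₁ t₁) (δ : PT S s₂ t₂) (ζ : PT S s₃ t₃) :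
      PermEq ((γ.hcomp δ).hcomp ζ) (γ.hcomp (δ.hcomp ζ))
  | vUnitL {s s' t} {σ : PT S s s'} {γ : PT S s' t} :
      IsEmptyMS σ → PermEq (σ.vcomp γ) γ
  | vUnitR {s t t'} {γ : PT S s t} {τ : PT S t t'} :
      IsEmptyMS τ → PermEq (γ.vcomp τ) γ
  | vAssoc {s t u v} (γ : PT S s t) (δ : PT S t u) (ζ : PT S u v) :
      PermEq ((γ.vcomp δ).vcomp ζ) (γ.vcomp (δ.vcomp ζ))
  | exchange {s₁ t₁ u₁ s₂ t₂ u₂} (γ : PT S s₁ t₁) (ζ : PT S t₁ u₁)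
      (δ : PT S s₂ t₂) (η : PT S t₂ u₂) :
      PermEq ((γ.hcomp δ).vcomp (ζ.hcomp η)) ((γ.vcomp ζ).hcomp (δ.vcomp η))

/-- `Resid Φ Ψ Θ` : the multistep `Φ` is contained in the multistep `Ψ`
(obtained from `Ψ` by replacing the non-selected occurrences of rule symbols by
their source strings), with residual `Θ = Ψ/Φ` (obtained from `Ψ` by replacing
the selected occurrences of rule symbols by their target strings). -/
inductive Resid : ∀ {s t u : List α}, PT S s t → PT S s u → PT S t u → Prop
  | eps : Resid .eps .eps .eps
  | letter (a : α) : Resid (.letter a) (.letter a) (.letter a)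
  | ruleKept (ρ : S.Rule) : Resid (.rule ρ) (.rule ρ) (ofString S (S.rhs ρ))
  | ruleSkipped (ρ : S.Rule) : Resid (ofString S (S.lhs ρ)) (.rule ρ) (.rule ρ)
  | hcomp {s₁ t₁ u₁ s₂ t₂ u₂} {Φ₁ : PT S s₁ t₁} {Ψ₁ : PT S s₁ u₁} {Θ₁ : PT S t₁ u₁}
      {Φ₂ : PT S s₂ t₂} {Ψ₂ : PT S s₂ u₂} {Θ₂ : PT S t₂ u₂} :
      Resid Φ₁ Ψ₁ Θ₁ → Resid Φ₂ Ψ₂ Θ₂ → Resid (Φ₁.hcomp Φ₂) (Ψ₁.hcomp Ψ₂) (Θ₁.hcomp Θ₂)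

/-- Containment `Φ ⊆ Ψ` of multisteps with the same source. -/
def Contained {s t u : List α} (Φ : PT S s t) (Ψ : PT S s u) : Prop := ∃ Θ, Resid Φ Ψ Θ

/-- A pair of consecutive multisteps `Φ·Ψ` is loath if there is a multistep `X`
co-initial with `Φ` such that `Φ ⊆ X` and the residual `ψ := X/Φ` is a single
step with `ψ ⊆ Ψ`. -/
def Loath {s t u : List α} (Φ : PT S s t) (Ψ : PT S t u) : Prop :=
  ∃ (v : List α) (X : PT S s v) (ψ : PT S t v),
    X.noVcomp ∧ Resid Φ X ψ ∧ IsStep ψ ∧ ∃ Θ : PT S v u, Resid ψ Ψ Θ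

/-- Right-associated vertical composition of single steps. -/
inductive IsStepSeq : ∀ {s t : List α}, PT S s t → Prop
  | single {s t} {φ : PT S s t} : IsStep φ → IsStepSeq φ
  | cons {s t u} {φ : PT S s t} {γ : PT S t u} : IsStep φ → IsStepSeq γ → IsStepSeq (φ.vcomp γ)

/-- A reduction: an empty multistep or a right-associated composition of steps. -/
def IsRed {s t : List α} (γ : PT S s t) : Prop := IsEmptyMS γ ∨ IsStepSeq γ

/-- Right-associated vertical composition of nonempty multisteps. -/
inductive IsMSSeq : ∀ {s t : List α}, PT S s t → Prop
  | single {s t} {Φ : PT S s t} : Φ.noVcomp → Φ.ruleCount ≠ 0 → IsMSSeq Φ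
  | cons {s t u} {Φ : PT S s t} {γ : PT S t u} :
      Φ.noVcomp → Φ.ruleCount ≠ 0 → IsMSSeq γ → IsMSSeq (Φ.vcomp γ)

/-- A multistep reduction: an empty multistep or a right-associated vertical
composition of nonempty multisteps. -/
def IsMSRed {s t : List α} (γ : PT S s t) : Prop := IsEmptyMS γ ∨ IsMSSeq γ

/-- `FirstMS γ Φ` : `Φ` is the first multistep of the multistep reduction `γ`. -/
inductive FirstMS : ∀ {s t v : List α}, PT S s t → PT S s v → Prop
  | base {s t} {Φ : PT S s t} : Φ.noVcomp → FirstMS Φ Φ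
  | cons {s t u} {Φ : PT S s t} {γ : PT S t u} : Φ.noVcomp → FirstMS (Φ.vcomp γ) Φ

/-- No pair of consecutive multisteps is loath. -/
inductive NoLoathPairs : ∀ {s t : List α}, PT S s t → Prop
  | base {s t} {γ : PT S s t} : γ.noVcomp → NoLoathPairs γ
  | cons {s t u} {Φ : PT S s t} {γ : PT S t u} : Φ.noVcomp → NoLoathPairs γ →
      (∀ {v : List α} (Ψ : PT S t v), FirstMS γ Ψ → ¬ Loath Φ Ψ) → NoLoathPairs (Φ.vcomp γ)

/-- A greedy multistep reduction. -/
def IsGreedyMSR {s t : List α} (γ : PT S s t) : Prop := IsMSRed γ ∧ NoLoathPairs γ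

/-- Swapping a loath pair of consecutive multisteps, anywhere within a
(right-associated) multistep reduction: a loath pair `Φ·Ψ` with witness `X`
(where `ψ := X/Φ` is a step with `ψ ⊆ Ψ`) is replaced by `X·(Ψ/ψ)`. -/
inductive Swap : ∀ {s t : List α}, PT S s t → PT S s t → Prop
  | head {s t u v} {Φ : PT S s t} {Ψ : PT S t u} {X : PT S s v} {ψ : PT S t v} {Θ : PT S v u} :
      X.noVcomp → Resid Φ X ψ → IsStep ψ → Resid ψ Ψ Θ → Swap (Φ.vcomp Ψ) (X.vcomp Θ)
  | headCons {s t u w v} {Φ : PT S s t} {Ψ : PT S t u} {γ : PT S u w} {X : PT S s v}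
      {ψ : PT S t v} {Θ : PT S v u} :
      X.noVcomp → Resid Φ X ψ → IsStep ψ → Resid ψ Ψ Θ →
      Swap (Φ.vcomp (Ψ.vcomp γ)) (X.vcomp (Θ.vcomp γ))
  | tail {s t u} {Φ : PT S s t} {γ γ' : PT S t u} :
      Φ.noVcomp → Swap γ γ' → Swap (Φ.vcomp γ) (Φ.vcomp γ')

/-- Removal of a trailing empty multistep. -/
inductive Drop : ∀ {s t : List α}, PT S s t → PT S s t → Prop
  | drop {s t} {Φ : PT S s t} {e : PT S t t} : IsEmptyMS e → Drop (Φ.vcomp e) Φ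
  | tail {s t u} {Φ : PT S s t} {γ γ' : PT S t u} : Drop γ γ' → Drop (Φ.vcomp γ) (Φ.vcomp γ')

/-- Swapping together with removal of trailing empty multisteps. -/
def SwapD {s t : List α} (γ δ : PT S s t) : Prop := Swap γ δ ∨ Drop γ δ

/-- The list of numbers of rule symbols of the constituent multisteps of a
(right-associated) multistep reduction, head first.  Its reverse, compared
lexicographically, is the Sekar–Ramakrishnan measure. -/
def msList : {s t : List α} → PT S s t → List ℕ
  | _, _, .vcomp Φ γ => ruleCount Φ :: msList γ
  | _, _, γ => [ruleCount γ]

/-- The rule occurrences of a multistep, with the starting position of the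
interval of letter positions each occupies in the source string. -/
def srcOccs : {s t : List α} → PT S s t → List (ℕ × S.Rule)
  | _, _, .eps => []
  | _, _, .letter _ => []
  | _, _, .rule ρ => [(0, ρ)]
  | _, _, @PT.hcomp _ _ s₁ _ _ _ γ δ =>
      srcOccs γ ++ (srcOccs δ).map (fun p => (s₁.length + p.1, p.2))
  | _, _, .vcomp _ _ => []

/-- The rule occurrences of a multistep, with the starting position of the
interval of letter positions each occupies in the target string. -/
def tgtOccs : {s t : List α} → PT S s t → List (ℕ × S.Rule)
  | _, _, .eps => []
  | _, _, .letter _ => []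
  | _, _, .rule ρ => [(0, ρ)]
  | _, _, @PT.hcomp _ _ _ t₁ _ _ γ δ =>
      tgtOccs γ ++ (tgtOccs δ).map (fun p => (t₁.length + p.1, p.2))
  | _, _, .vcomp _ _ => []

end PT

/-- A single rewrite step on strings: replacing an occurrence of the left-hand
side of a rule by its right-hand side. -/
def StrStep (S : SRS α) (x y : List α) : Prop :=
  ∃ (u v : List α) (ρ : S.Rule), x = u ++ S.lhs ρ ++ v ∧ y = u ++ S.rhs ρ ++ v

end SRS

namespace SRS.PT

variable {α : Type u} {S : SRS α}

theorem isEmptyMS_ofString (s : List α) : IsEmptyMS (ofString S s) := by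
  induction s with
  | nil => exact ⟨trivial, rfl⟩
  | cons a s ih => exact ⟨⟨trivial, ih.1⟩, by simp [ofString, ruleCount, ih.2]⟩

theorem src_eq_tgt_of_isEmptyMS {s t : List α} {γ : PT S s t} (h : IsEmptyMS γ) : s = t := by
  induction γ with
  | eps => rfl
  | letter a => rfl
  | rule ρ => exact absurd h.2 one_ne_zero
  | hcomp γ δ ihγ ihδ =>
    obtain ⟨hγ, hδ⟩ := Nat.add_eq_zero_iff.1 h.2
    rw [ihγ ⟨h.1.1, hγ⟩, ihδ ⟨h.1.2, hδ⟩]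
  | vcomp => exact h.1.elim

theorem IsEmptyMS.hcomp {s₁ t₁ s₂ t₂ : List α} {γ : PT S s₁ t₁} {δ : PT S s₂ t₂}
    (hγ : IsEmptyMS γ) (hδ : IsEmptyMS δ) : IsEmptyMS (γ.hcomp δ) :=
  ⟨⟨hγ.1, hδ.1⟩, Nat.add_eq_zero_iff.2 ⟨hγ.2, hδ.2⟩⟩

theorem IsStep.hcomp_isEmptyMS {s₁ t₁ s₂ t₂ : List α} {γ : PT S s₁ t₁} {δ : PT S s₂ t₂}
    (hγ : IsStep γ) (hδ : IsEmptyMS δ) : IsStep (γ.hcomp δ) :=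
  ⟨⟨hγ.1, hδ.1⟩, by simp [ruleCount, hγ.2, hδ.2]⟩

theorem IsEmptyMS.hcomp_isStep {s₁ t₁ s₂ t₂ : List α} {γ : PT S s₁ t₁} {δ : PT S s₂ t₂}
    (hγ : IsEmptyMS γ) (hδ : IsStep δ) : IsStep (γ.hcomp δ) :=
  ⟨⟨hγ.1, hδ.1⟩, by simp [ruleCount, hγ.2, hδ.2]⟩

/-- Vertical composition of step sequences, up to permutation equivalence. -/
theorem IsStepSeq.exists_vcomp {s t u : List α} {γ : PT S s t} (hγ : IsStepSeq γ)
    {δ : PT S t u} (hδ : IsStepSeq δ) :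
    ∃ ζ : PT S s u, IsStepSeq ζ ∧ PermEq (γ.vcomp δ) ζ := by
  induction hγ with
  | single h => exact ⟨_, .cons h hδ, .refl _⟩
  | cons h _ ih =>
    obtain ⟨ζ, hζ, e⟩ := ih hδ
    exact ⟨_, .cons h hζ, (PermEq.vAssoc _ _ _).trans (.vcongr (.refl _) e)⟩

/-- Vertical composition of reductions, up to permutation equivalence. -/
theorem IsRed.exists_vcomp {s t u : List α} {γ : PT S s t} (hγ : IsRed γ)
    {δ : PT S t u} (hδ : IsRed δ) :
    ∃ ζ : PT S s u, IsRed ζ ∧ PermEq (γ.vcomp δ) ζ := by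
  rcases hγ with hγ | hγ
  · obtain rfl := src_eq_tgt_of_isEmptyMS hγ
    exact ⟨δ, hδ, .vUnitL hγ⟩
  · rcases hδ with hδ | hδ
    · obtain rfl := src_eq_tgt_of_isEmptyMS hδ
      exact ⟨γ, .inr hγ, .vUnitR hδ⟩
    · obtain ⟨ζ, hζ, e⟩ := hγ.exists_vcomp hδ
      exact ⟨ζ, .inr hζ, e⟩

/-- Reductions are closed under right whiskering, up to permutation equivalence. -/
theorem IsRed.exists_hcomp_ofString {s t : List α} {γ : PT S s t} (hγ : IsRed γ) (r : List α) :
    ∃ ζ : PT S (s ++ r) (t ++ r), IsRed ζ ∧ PermEq (γ.hcomp (ofString S r)) ζ := by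
  have hr := isEmptyMS_ofString (S := S) r
  rcases hγ with hγ | hγ
  · exact ⟨_, .inl (hγ.hcomp hr), .refl _⟩
  · suffices h : ∃ ζ : PT S (s ++ r) (t ++ r),
        IsStepSeq ζ ∧ PermEq (γ.hcomp (ofString S r)) ζ from
      h.imp fun _ h => ⟨.inr h.1, h.2⟩
    induction hγ with
    | single h => exact ⟨_, .single (h.hcomp_isEmptyMS hr), .refl _⟩
    | cons h _ ih =>
      obtain ⟨ζ, hζ, e⟩ := ih
      exact ⟨_, .cons (h.hcomp_isEmptyMS hr) hζ,
        (PermEq.hcongr (.refl _) (PermEq.vUnitL hr).symm).trans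
          ((PermEq.exchange _ _ _ _).symm.trans (.vcongr (.refl _) e))⟩

/-- Reductions are closed under left whiskering, up to permutation equivalence. -/
theorem IsRed.exists_ofString_hcomp {s t : List α} {γ : PT S s t} (hγ : IsRed γ) (r : List α) :
    ∃ ζ : PT S (r ++ s) (r ++ t), IsRed ζ ∧ PermEq ((ofString S r).hcomp γ) ζ := by
  have hr := isEmptyMS_ofString (S := S) r
  rcases hγ with hγ | hγ
  · exact ⟨_, .inl (hr.hcomp hγ), .refl _⟩
  · suffices h : ∃ ζ : PT S (r ++ s) (r ++ t),
        IsStepSeq ζ ∧ PermEq ((ofString S r).hcomp γ) ζ from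
      h.imp fun _ h => ⟨.inr h.1, h.2⟩
    induction hγ with
    | single h => exact ⟨_, .single (hr.hcomp_isStep h), .refl _⟩
    | cons h _ ih =>
      obtain ⟨ζ, hζ, e⟩ := ih
      exact ⟨_, .cons (hr.hcomp_isStep h) hζ,
        (PermEq.hcongr (PermEq.vUnitL hr).symm (.refl _)).trans
          ((PermEq.exchange _ _ _ _).symm.trans (.vcongr (.refl _) e))⟩

/-- Horizontal composition is a vertical composition of whiskerings. -/
theorem permEq_hcomp_vcomp_whisker {s₁ t₁ s₂ t₂ : List α} (γ : PT S s₁ t₁) (δ : PT S s₂ t₂) :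
    PermEq (γ.hcomp δ) ((γ.hcomp (ofString S s₂)).vcomp ((ofString S t₁).hcomp δ)) :=
  ((PermEq.exchange _ _ _ _).trans
    (.hcongr (.vUnitR (isEmptyMS_ofString _)) (.vUnitL (isEmptyMS_ofString _)))).symm

end SRS.PT

open SRS.PT in
/-- Logicality: every proof term is permutation equivalent to a reduction with
the same source and target. -/
theorem statement0 {α : Type u} {S : SRS α} {s t : List α} (γ : SRS.PT S s t) :
    ∃ γ' : SRS.PT S s t, IsRed γ' ∧ PermEq γ γ' := by
  induction γ with
  | eps => exact ⟨.eps, .inl ⟨trivial, rfl⟩, .refl _⟩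
  | letter a => exact ⟨.letter a, .inl ⟨trivial, rfl⟩, .refl _⟩
  | rule ρ => exact ⟨.rule ρ, .inr (.single ⟨trivial, rfl⟩), .refl _⟩
  | hcomp γ δ ihγ ihδ =>
    obtain ⟨γ', hγ, eγ⟩ := ihγ
    obtain ⟨δ', hδ, eδ⟩ := ihδ
    obtain ⟨γ'', hγ', eγ'⟩ := hγ.exists_hcomp_ofString _
    obtain ⟨δ'', hδ', eδ'⟩ := hδ.exists_ofString_hcomp _
    obtain ⟨ζ, hζ, e⟩ := hγ'.exists_vcomp hδ'
    exact ⟨ζ, hζ, (PermEq.hcongr eγ eδ).trans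
      ((permEq_hcomp_vcomp_whisker _ _).trans ((PermEq.vcongr eγ' eδ').trans e))⟩
  | vcomp γ δ ihγ ihδ =>
    obtain ⟨γ', hγ, eγ⟩ := ihγ
    obtain ⟨δ', hδ, eδ⟩ := ihδ
    obtain ⟨ζ, hζ, e⟩ := hγ.exists_vcomp hδ
    exact ⟨ζ, hζ, (PermEq.vcongr eγ eδ).trans e⟩
end

section
/- For strings s and t over the alphabet of a string rewrite system (Σ, R), there exists a proof term with source s and target t if and only if t is reachable from s by a finite sequence of rewrite steps, where a single rewrite step replaces an occurrence of the left-hand side ℓ of a rule ℓ → r in R by its right-hand side r (i.e., rewrites uℓv to urv). -/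
universe u

namespace SRS

variable {α : Type u} {S : SRS α}

theorem StrStep.append_left (w : List α) {x y : List α} (h : S.StrStep x y) :
    S.StrStep (w ++ x) (w ++ y) := by
  obtain ⟨u, v, ρ, rfl, rfl⟩ := h
  exact ⟨w ++ u, v, ρ, by simp, by simp⟩

theorem StrStep.append_right (w : List α) {x y : List α} (h : S.StrStep x y) :
    S.StrStep (x ++ w) (y ++ w) := by
  obtain ⟨u, v, ρ, rfl, rfl⟩ := h
  exact ⟨u, v ++ w, ρ, by simp, by simp⟩

/-- A rewrite step as a proof term. -/
theorem StrStep.nonempty_PT {x y : List α} (h : S.StrStep x y) : Nonempty (PT S x y) := by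
  obtain ⟨u, v, ρ, rfl, rfl⟩ := h
  exact ⟨((PT.ofString S u).hcomp (.rule ρ)).hcomp (PT.ofString S v)⟩

/-- The target of a proof term is reachable from its source. -/
theorem PT.reflTransGen {s t : List α} (γ : PT S s t) :
    Relation.ReflTransGen S.StrStep s t := by
  induction γ with
  | eps => exact .refl
  | letter a => exact .refl
  | rule ρ => exact .single ⟨[], [], ρ, by simp, by simp⟩
  | hcomp _ _ ih₁ ih₂ =>
    exact (ih₁.lift (· ++ _) fun _ _ h => h.append_right _).trans
      (ih₂.lift (_ ++ ·) fun _ _ h => h.append_left _)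
  | vcomp _ _ ih₁ ih₂ => exact ih₁.trans ih₂

end SRS

/-- There is a proof term from `s` to `t` iff `t` is reachable from `s` by
finitely many rewrite steps. -/
theorem statement2 {α : Type u} (S : SRS α) (s t : List α) :
    Nonempty (SRS.PT S s t) ↔ Relation.ReflTransGen (SRS.StrStep S) s t := by
  refine ⟨fun ⟨γ⟩ => γ.reflTransGen, fun h => ?_⟩
  induction h with
  | refl => exact ⟨SRS.PT.ofString S s⟩
  | tail _ hstep ih =>
    obtain ⟨γ⟩ := ih
    obtain ⟨δ⟩ := hstep.nonempty_PT
    exact ⟨γ.vcomp δ⟩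
end

section
/- If Φ and Ψ are multisteps with the same source and Φ ⊆ Ψ with Φ nonempty (containing at least one rule symbol), then the residual Ψ/Φ contains strictly fewer occurrences of rule symbols than Ψ. -/
universe u

namespace SRS.PT

@[simp]
theorem ruleCount_ofString {α : Type u} (S : SRS α) (s : List α) :
    (ofString S s).ruleCount = 0 := by
  induction s with
  | nil => rfl
  | cons a s ih => simp [ofString, ruleCount, ih]

/-- The rule symbols of `Ψ` are split between a contained multistep and its residual. -/
theorem Resid.ruleCount_add {α : Type u} {S : SRS α} {s t u : List α}
    {Φ : PT S s t} {Ψ : PT S s u} {Θ : PT S t u} (h : Resid Φ Ψ Θ) :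
    Φ.ruleCount + Θ.ruleCount = Ψ.ruleCount := by
  induction h with
  | eps => rfl
  | letter a => rfl
  | ruleKept ρ => simp [ruleCount]
  | ruleSkipped ρ => simp [ruleCount]
  | hcomp _ _ ih₁ ih₂ => simp only [ruleCount]; omega

end SRS.PT

open SRS.PT in
/-- If `Φ ⊆ Ψ` with `Φ` nonempty, then the residual `Ψ/Φ` has strictly fewer
rule symbols than `Ψ`. -/
theorem statement4 {α : Type u} {S : SRS α} {s t u : List α}
    {Φ : SRS.PT S s t} {Ψ : SRS.PT S s u} {Θ : SRS.PT S t u}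
    (h : Resid Φ Ψ Θ) (hne : Φ.ruleCount ≠ 0) :
    Θ.ruleCount < Ψ.ruleCount := by
  have := h.ruleCount_add
  omega
end

section
/- In the string rewrite system over the alphabet {A, B, C} with rules α : A → BBB, β : BB → B, and γ : BB → C, the two reductions A → BBB → BB → C contracting first the left occurrence of BB in BBB (i.e., the proof term α · βB · γ) and contracting first the right occurrence of BB in BBB (i.e., the proof term α · Bβ · γ) have the same source A and the same target C, but are not permutation equivalent. -/
universe u

/-- The alphabet {A, B, C}. -/
inductive L16 : Type
  | A | B | C

/-- Rules α : A → BBB, β : BB → B, γ : BB → C. -/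
inductive R16 : Type
  | ra | rb | rc

/-- The string rewrite system with rules α : A → BBB, β : BB → B, γ : BB → C. -/
def S16 : SRS L16 where
  Rule := R16
  lhs := fun ρ => match ρ with
    | .ra => [.A]
    | .rb => [.B, .B]
    | .rc => [.B, .B]
  rhs := fun ρ => match ρ with
    | .ra => [.B, .B, .B]
    | .rb => [.B]
    | .rc => [.C]
  lhs_ne := fun ρ => by cases ρ <;> simp
  rhs_ne := fun ρ => by cases ρ <;> simp

/-- The proof term `α · βB · γ` (contracting first the left occurrence of BB). -/
def pt1 : SRS.PT S16 [L16.A] [L16.C] :=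
  SRS.PT.vcomp (SRS.PT.rule (S := S16) R16.ra)
    (SRS.PT.vcomp
      (SRS.PT.hcomp (SRS.PT.rule (S := S16) R16.rb) (SRS.PT.letter (S := S16) L16.B))
      (SRS.PT.rule (S := S16) R16.rc))

/-- The proof term `α · Bβ · γ` (contracting first the right occurrence of BB). -/
def pt2 : SRS.PT S16 [L16.A] [L16.C] :=
  SRS.PT.vcomp (SRS.PT.rule (S := S16) R16.ra)
    (SRS.PT.vcomp
      (SRS.PT.hcomp (SRS.PT.letter (S := S16) L16.B) (SRS.PT.rule (S := S16) R16.rb))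
      (SRS.PT.rule (S := S16) R16.rc))

namespace SRS.PT

universe v

variable {α : Type u} {S : SRS α} {X : Type v}

/-- The interpretation of a proof term as an operation on lists of values, one value for each
letter, given interpretations of the rules. -/
def eval (f : S.Rule → List X → List X) : {s t : List α} → PT S s t → List X → List X
  | _, _, .eps, xs => xs
  | _, _, .letter _, xs => xs
  | _, _, .rule ρ, xs => f ρ xs
  | _, _, @PT.hcomp _ _ s₁ _ _ _ γ δ, xs =>
      eval f γ (xs.take s₁.length) ++ eval f δ (xs.drop s₁.length)
  | _, _, .vcomp γ δ, xs => eval f δ (eval f γ xs)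

theorem length_eval {f : S.Rule → List X → List X}
    (hf : ∀ ρ xs, (f ρ xs).length = (S.rhs ρ).length) {s t : List α} (γ : PT S s t) :
    ∀ xs : List X, xs.length = s.length → (eval f γ xs).length = t.length := by
  induction γ with
  | eps => exact fun _ h => h
  | letter a => exact fun _ h => h
  | rule ρ => exact fun xs _ => hf ρ xs
  | hcomp γ δ ihγ ihδ =>
    intro xs h
    rw [List.length_append] at h
    simp only [eval, List.length_append]
    rw [ihγ _ (by simp [h]), ihδ _ (by simp [h])]
  | vcomp γ δ ihγ ihδ => exact fun xs h => ihδ _ (ihγ _ h)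

theorem IsEmptyMS.source_eq_target {s t : List α} {γ : PT S s t} (h : γ.IsEmptyMS) : s = t := by
  obtain ⟨hv, hc⟩ := h
  induction γ with
  | eps => rfl
  | letter a => rfl
  | rule ρ => simp [ruleCount] at hc
  | hcomp γ δ ihγ ihδ =>
    simp only [ruleCount, Nat.add_eq_zero_iff] at hc
    rw [ihγ hv.1 hc.1, ihδ hv.2 hc.2]
  | vcomp γ δ => exact hv.elim

theorem IsEmptyMS.eval_eq (f : S.Rule → List X → List X) {s t : List α} {γ : PT S s t}
    (h : γ.IsEmptyMS) (xs : List X) : eval f γ xs = xs := by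
  obtain ⟨hv, hc⟩ := h
  induction γ generalizing xs with
  | eps => rfl
  | letter a => rfl
  | rule ρ => simp [ruleCount] at hc
  | hcomp γ δ ihγ ihδ =>
    simp only [ruleCount, Nat.add_eq_zero_iff] at hc
    simp only [eval]
    rw [ihγ _ hv.1 hc.1, ihδ _ hv.2 hc.2, List.take_append_drop]
  | vcomp γ δ => exact hv.elim

/-- Permutation equivalent proof terms have the same source, target and interpretation. -/
theorem PermEq.eval_eq {f : S.Rule → List X → List X}
    (hf : ∀ ρ xs, (f ρ xs).length = (S.rhs ρ).length) {s t s' t' : List α}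
    {γ : PT S s t} {δ : PT S s' t'} (h : PermEq γ δ) :
    s = s' ∧ t = t' ∧ ∀ xs : List X, xs.length = s.length → eval f γ xs = eval f δ xs := by
  induction h with
  | refl γ => exact ⟨rfl, rfl, fun _ _ => rfl⟩
  | symm _ ih =>
    obtain ⟨rfl, rfl, ih⟩ := ih
    exact ⟨rfl, rfl, fun xs hx => (ih xs hx).symm⟩
  | trans _ _ ih₁ ih₂ =>
    obtain ⟨rfl, rfl, ih₁⟩ := ih₁
    obtain ⟨rfl, rfl, ih₂⟩ := ih₂
    exact ⟨rfl, rfl, fun xs hx => (ih₁ xs hx).trans (ih₂ xs hx)⟩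
  | hcongr _ _ ih₁ ih₂ =>
    obtain ⟨rfl, rfl, ih₁⟩ := ih₁
    obtain ⟨rfl, rfl, ih₂⟩ := ih₂
    refine ⟨rfl, rfl, fun xs hx => ?_⟩
    rw [List.length_append] at hx
    simp only [eval]
    rw [ih₁ _ (by simp [hx]), ih₂ _ (by simp [hx])]
  | @vcongr _ _ _ _ _ _ γ _ _ _ _ _ ih₁ ih₂ =>
    obtain ⟨rfl, rfl, ih₁⟩ := ih₁
    obtain ⟨-, rfl, ih₂⟩ := ih₂
    refine ⟨rfl, rfl, fun xs hx => ?_⟩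
    simp only [eval]
    rw [ih₂ _ (length_eval hf γ xs hx), ih₁ xs hx]
  | hUnitL γ => exact ⟨rfl, rfl, fun xs _ => by simp [eval]⟩
  | hUnitR γ =>
    refine ⟨List.append_nil _, List.append_nil _, fun xs hx => ?_⟩
    rw [List.append_nil] at hx
    simp [eval, ← hx]
  | hAssoc γ δ ζ =>
    refine ⟨List.append_assoc .., List.append_assoc .., fun xs _ => ?_⟩
    simp [eval, List.take_take, List.drop_take]
  | vUnitL hσ =>
    refine ⟨hσ.source_eq_target, rfl, fun xs _ => ?_⟩
    simp only [eval, hσ.eval_eq]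
  | vUnitR hτ =>
    refine ⟨rfl, hτ.source_eq_target.symm, fun xs _ => ?_⟩
    simp only [eval, hτ.eval_eq]
  | vAssoc γ δ ζ => exact ⟨rfl, rfl, fun _ _ => rfl⟩
  | @exchange s₁ t₁ u₁ s₂ t₂ u₂ γ ζ δ η =>
    refine ⟨rfl, rfl, fun xs hx => ?_⟩
    rw [List.length_append] at hx
    have h := length_eval hf γ (xs.take s₁.length) (by simp [hx])
    simp only [eval]
    rw [List.take_left' h, List.drop_left' h]

end SRS.PT

/-- An interpretation of the rules by Boolean operations: `α` produces a fixed triple, `β` is the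
first projection and `γ` is the second projection. -/
def ruleEval16 : S16.Rule → List Bool → List Bool
  | .ra, _ => [false, false, true]
  | .rb, xs => [xs.headD false]
  | .rc, xs => [xs.getD 1 false]

theorem length_ruleEval16 (ρ : S16.Rule) (xs : List Bool) :
    (ruleEval16 ρ xs).length = (S16.rhs ρ).length := by
  cases ρ <;> rfl

/-- The two reductions `α · βB · γ` and `α · Bβ · γ` have the same source `A`
and target `C` but are not permutation equivalent. -/
theorem statement16 :
    pt1.src = [L16.A] ∧ pt2.src = [L16.A] ∧ pt1.tgt = [L16.C] ∧ pt2.tgt = [L16.C] ∧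
    ¬ SRS.PT.PermEq pt1 pt2 := by
  refine ⟨rfl, rfl, rfl, rfl, fun h => ?_⟩
  have key := (h.eval_eq length_ruleEval16).2.2 [false] rfl
  simp [pt1, pt2, SRS.PT.eval, ruleEval16, S16] at key
end
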